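/- arXiv:2308.16702 — 7 statements merged into one kernel-verified Lean document; each statement's English description precedes it below -/
import Mathlib

section
/- Let A be a ℤ_q-algebra and let x₁, …, x_n ∈ A be pairwise q-commuting elements: there are integers c_{ij} with c_{ij} = −c_{ji} such that x_i x_j = q^{c_{ij}} · x_j x_i for all i ≠ j. Then the Weyl normalization of the product is invariant under permutations: for every permutation σ of {1, …, n} one has q^{-\frac{1}{2}\sum_{i<j} c_{ij}} · x₁ x₂ ⋯ x_n = q^{-\frac{1}{2}\sum_{i<j} c_{σ(i)σ(j)}} · x_{σ(1)} x_{σ(2)} ⋯ x_{σ(n)} (where q^{-m/2} means T^{-m}). -/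
/-- The sum of `c a b` over all pairs of entries of a list with `a` occurring before `b`. -/
def List.pairSum {ι : Type*} (c : ι → ι → ℤ) : List ι → ℤ
  | [] => 0
  | a :: l => (l.map (c a)).sum + List.pairSum c l

theorem List.pairSum_ofFn {ι : Type*} (c : ι → ι → ℤ) {n : ℕ} (f : Fin n → ι) :
    (List.ofFn f).pairSum c =
      ∑ p ∈ Finset.univ.filter (fun p : Fin n × Fin n => p.1 < p.2), c (f p.1) (f p.2) := by
  induction n with
  | zero => simp [List.pairSum]
  | succ n ih =>
    rw [List.ofFn_succ, List.pairSum, ih]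
    simp only [Finset.sum_filter, Fintype.sum_prod_type, Fin.sum_univ_succ]
    simp [List.map_ofFn, List.sum_ofFn]

/-- The Weyl normalization of the product of `q`-commuting elements along a list of indices
is invariant under permutations of the list. -/
theorem List.Perm.weyl_smul_prod_eq {A ι : Type*} [Ring A] [Algebra (LaurentPolynomial ℤ) A]
    {x : ι → A} {c : ι → ι → ℤ} (hanti : ∀ i j, c i j = - c j i)
    (hcom : ∀ i j, i ≠ j →
      x i * x j = (LaurentPolynomial.T (2 * c i j) : LaurentPolynomial ℤ) • (x j * x i))
    {l₁ l₂ : List ι} (h : l₁.Perm l₂) :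
    (LaurentPolynomial.T (-l₁.pairSum c) : LaurentPolynomial ℤ) • (l₁.map x).prod =
      (LaurentPolynomial.T (-l₂.pairSum c) : LaurentPolynomial ℤ) • (l₂.map x).prod := by
  induction h with
  | nil => rfl
  | @cons a l₁ l₂ h ih =>
    simp only [List.pairSum, List.map_cons, List.prod_cons, neg_add, LaurentPolynomial.T_add,
      mul_smul, (h.map (c a)).sum_eq]
    rw [← mul_smul_comm, ih, mul_smul_comm]
  | swap a b l =>
    by_cases hab : a = b
    · rw [hab]
    · simp only [List.pairSum, List.map_cons, List.prod_cons, List.sum_cons, ← mul_assoc]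
      rw [hcom b a (Ne.symm hab), smul_mul_assoc, smul_smul, ← LaurentPolynomial.T_add,
        hanti a b]
      congr 2
      ring
  | trans _ _ ih₁ ih₂ => exact ih₁.trans ih₂


/-- Let `A` be a `ℤ_q`-algebra (over `ℤ[T,T⁻¹]`, with `q^{1/2} := T`,
`q := T²`) and let `x₁, …, x_n ∈ A` be pairwise `q`-commuting: `x_i x_j = q^{c_{ij}} x_j x_i`
with `c_{ij} = -c_{ji}`.  Then the Weyl normalization of the product is invariant under
permutations: for every permutation `σ`,
`q^{-½ ∑_{i<j} c_{ij}} • x₁⋯x_n = q^{-½ ∑_{i<j} c_{σ(i)σ(j)}} • x_{σ(1)}⋯x_{σ(n)}`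
(where `q^{-m/2}` means `T^{-m}`). -/
theorem stmt2 {A : Type*} [Ring A] [Algebra (LaurentPolynomial ℤ) A]
    (n : ℕ) (x : Fin n → A) (c : Fin n → Fin n → ℤ)
    (hanti : ∀ i j, c i j = - c j i)
    (hcom : ∀ i j, i ≠ j →
      x i * x j = (LaurentPolynomial.T (2 * c i j) : LaurentPolynomial ℤ) • (x j * x i))
    (σ : Equiv.Perm (Fin n)) :
    (LaurentPolynomial.T
        (-(∑ p ∈ Finset.univ.filter (fun p : Fin n × Fin n => p.1 < p.2), c p.1 p.2)) :
      LaurentPolynomial ℤ) • (List.ofFn x).prod =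
    (LaurentPolynomial.T
        (-(∑ p ∈ Finset.univ.filter (fun p : Fin n × Fin n => p.1 < p.2), c (σ p.1) (σ p.2))) :
      LaurentPolynomial ℤ) • (List.ofFn (fun i => x (σ i))).prod := by
  rw [← List.pairSum_ofFn c (fun i => i), ← List.pairSum_ofFn c (fun i => σ i)]
  have h := (Equiv.Perm.map_finRange_perm σ).symm.weyl_smul_prod_eq hanti hcom
  simpa [List.ofFn_eq_map, Function.comp_def] using h
end

section
/- Let R be a commutative ring with a distinguished unit t, and write q^{1/2} := t, q := t². Let A_R be the quotient of the free R-algebra on two generators y₊, y₋ by the two-sided ideal generated by the single element q·y₊y₋ − q⁻¹·y₋y₊ − (q − q⁻¹)·1. Then the family of images of the ordered monomials y₊^{k₁} y₋^{k₂}, indexed by (k₁, k₂) ∈ ℕ², is a basis of A_R as an R-module. -/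
/-- The defining relation of the (LRY/Roger–Yang) skein algebra of the 1-marked
monogon over a commutative ring `R` with distinguished unit `t` (`q^{1/2} := t`,
`q := t²`): the single relation `q·y₊y₋ = q⁻¹·y₋y₊ + (q − q⁻¹)·1` in the free
algebra on the two generators `y₊ = ι 0`, `y₋ = ι 1`. -/
inductive MonogonRel (R : Type*) [CommRing R] (t : Rˣ) :
    FreeAlgebra R (Fin 2) → FreeAlgebra R (Fin 2) → Prop
  | rel : MonogonRel R t
      (((t : R) ^ 2) • (FreeAlgebra.ι R (0 : Fin 2) * FreeAlgebra.ι R (1 : Fin 2)))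
      ((((t⁻¹ : Rˣ) : R) ^ 2) • (FreeAlgebra.ι R (1 : Fin 2) * FreeAlgebra.ι R (0 : Fin 2)) +
        ((t : R) ^ 2 - ((t⁻¹ : Rˣ) : R) ^ 2) • (1 : FreeAlgebra R (Fin 2)))

/-- Left multiplication by `y₊` in the basis of ordered monomials `y₊^a y₋^b`. -/
noncomputable def monogonPlus (R : Type*) [CommRing R] : Module.End R (ℕ × ℕ →₀ R) :=
  Finsupp.linearCombination R fun k => Finsupp.single (k.1 + 1, k.2) 1

/-- Left multiplication by `y₋` in the basis of ordered monomials `y₊^a y₋^b`, where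
`u` plays the role of `q²`. -/
noncomputable def monogonMinus {R : Type*} [CommRing R] (u : R) :
    Module.End R (ℕ × ℕ →₀ R) :=
  Finsupp.linearCombination R fun k =>
    u ^ k.1 • Finsupp.single (k.1, k.2 + 1) 1 + (1 - u ^ k.1) • Finsupp.single (k.1 - 1, k.2) 1

theorem monogonPlus_single {R : Type*} [CommRing R] (a b : ℕ) :
    monogonPlus R (Finsupp.single (a, b) 1) = Finsupp.single (a + 1, b) 1 := by
  simp [monogonPlus]

theorem monogonMinus_single {R : Type*} [CommRing R] (u : R) (a b : ℕ) :
    monogonMinus u (Finsupp.single (a, b) 1) =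
      u ^ a • Finsupp.single (a, b + 1) 1 + (1 - u ^ a) • Finsupp.single (a - 1, b) 1 := by
  simp only [monogonMinus, Finsupp.linearCombination_single, one_smul]

theorem monogonMinus_mul_monogonPlus {R : Type*} [CommRing R] (u : R) :
    monogonMinus u * monogonPlus R = u • (monogonPlus R * monogonMinus u) + (1 - u) • 1 := by
  refine Finsupp.lhom_ext' fun ⟨a, b⟩ => LinearMap.ext_ring ?_
  simp only [LinearMap.comp_apply, Finsupp.lsingle_apply, Module.End.mul_apply,
    LinearMap.add_apply, LinearMap.smul_apply, Module.End.one_apply, monogonPlus_single,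
    monogonMinus_single, map_add, map_smul]
  cases a with
  | zero => simp
  | succ a =>
    simp only [Nat.add_sub_cancel]
    module

/-- The commutation relation of `MonogonRel`, solved for `y * x`. -/
theorem monogon_relation_iff {R B : Type*} [CommRing R] [Ring B] [Algebra R B] (t : Rˣ)
    (x y : B) :
    (t : R) ^ 2 • (x * y) = ((t⁻¹ : Rˣ) : R) ^ 2 • (y * x) +
        ((t : R) ^ 2 - ((t⁻¹ : Rˣ) : R) ^ 2) • (1 : B) ↔
      y * x = (t : R) ^ 4 • (x * y) + (1 - (t : R) ^ 4) • (1 : B) := by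
  have h : (t : R) * ((t⁻¹ : Rˣ) : R) = 1 := t.mul_inv
  constructor <;> intro e
  · have e' : ((t⁻¹ : Rˣ) : R) ^ 2 • (y * x) = _ := eq_sub_of_add_eq e.symm
    calc y * x = (t : R) ^ 2 • (((t⁻¹ : Rˣ) : R) ^ 2 • (y * x)) := by
          rw [smul_smul, ← mul_pow, h, one_pow, one_smul]
      _ = _ := by
          rw [e']
          match_scalars <;> grind
  · rw [e]
    match_scalars <;> grind

/-- The action of the monogon algebra on the free module spanned by ordered monomials. -/
noncomputable def monogonRep {R : Type*} [CommRing R] (t : Rˣ) :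
    RingQuot (MonogonRel R t) →ₐ[R] Module.End R (ℕ × ℕ →₀ R) :=
  RingQuot.liftAlgHom R ⟨FreeAlgebra.lift R ![monogonPlus R, monogonMinus ((t : R) ^ 4)], by
    rintro _ _ ⟨⟩
    simpa using (monogon_relation_iff t (monogonPlus R) (monogonMinus ((t : R) ^ 4))).2
      (monogonMinus_mul_monogonPlus ((t : R) ^ 4))⟩

theorem monogonMinus_pow_single {R : Type*} [CommRing R] (u : R) (n : ℕ) :
    (monogonMinus u ^ n) (Finsupp.single (0, 0) 1) = Finsupp.single (0, n) 1 := by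
  induction n with
  | zero => simp
  | succ n ih => simp [pow_succ', ih, monogonMinus_single]

theorem monogonPlus_pow_single {R : Type*} [CommRing R] (m n : ℕ) :
    (monogonPlus R ^ m) (Finsupp.single (0, n) 1) = Finsupp.single (m, n) 1 := by
  induction m with
  | zero => simp
  | succ m ih => simp [pow_succ', ih, monogonPlus_single]

theorem monogonRep_monomial {R : Type*} [CommRing R] (t : Rˣ) (k : ℕ × ℕ) :
    monogonRep t
      ((RingQuot.mkAlgHom R (MonogonRel R t) (FreeAlgebra.ι R (0 : Fin 2))) ^ k.1 *
      (RingQuot.mkAlgHom R (MonogonRel R t) (FreeAlgebra.ι R (1 : Fin 2))) ^ k.2)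
      (Finsupp.single (0, 0) 1) = Finsupp.single k 1 := by
  simp [monogonRep, monogonMinus_pow_single, monogonPlus_pow_single]

/-- Moving `y` past a power of `x` when `y * x = u • (x * y) + (1 - u) • 1`. -/
theorem mul_pow_of_monogon_relation {R B : Type*} [CommRing R] [Ring B] [Algebra R B] {u : R}
    {x y : B} (h : y * x = u • (x * y) + (1 - u) • (1 : B)) (n : ℕ) :
    y * x ^ n = u ^ n • (x ^ n * y) + (1 - u ^ n) • x ^ (n - 1) := by
  induction n with
  | zero => simp
  | succ n ih =>
    rw [pow_succ, ← mul_assoc, ih, add_mul, smul_mul_assoc, mul_assoc (x ^ n) y x, h]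
    simp only [mul_add, mul_smul_comm, mul_one, smul_mul_assoc, ← mul_assoc, Nat.add_sub_cancel]
    cases n with
    | zero => simp
    | succ n =>
      simp only [Nat.add_sub_cancel, ← pow_succ]
      module

theorem mul_mem_of_forall_ι_mul_mem {R X B : Type*} [CommRing R] [Ring B] [Algebra R B]
    (f : FreeAlgebra R X →ₐ[R] B) (S : Submodule R B)
    (hS : ∀ i, ∀ s ∈ S, f (FreeAlgebra.ι R i) * s ∈ S) (w : FreeAlgebra R X) :
    ∀ s ∈ S, f w * s ∈ S := by
  induction w using FreeAlgebra.induction with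
  | grade0 r =>
    intro s hs
    simpa [← Algebra.smul_def] using S.smul_mem r hs
  | grade1 i => exact hS i
  | mul a b ha hb =>
    intro s hs
    simpa [mul_assoc] using ha _ (hb s hs)
  | add a b ha hb =>
    intro s hs
    simpa [add_mul] using S.add_mem (ha s hs) (hb s hs)

/-- Let `A_R = R⟨y₊,y₋⟩/(q y₊y₋ − q⁻¹ y₋y₊ = q − q⁻¹)` with `q = t²`
for a distinguished unit `t` of the commutative ring `R`.  Then the family of images of
the ordered monomials `y₊^{k₁} y₋^{k₂}`, `(k₁,k₂) ∈ ℕ²`, is a basis of `A_R` as an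
`R`-module (it is linearly independent and spans). -/
theorem stmt5 {R : Type*} [CommRing R] (t : Rˣ) :
    LinearIndependent R (fun k : ℕ × ℕ =>
      (RingQuot.mkAlgHom R (MonogonRel R t) (FreeAlgebra.ι R (0 : Fin 2))) ^ k.1 *
      (RingQuot.mkAlgHom R (MonogonRel R t) (FreeAlgebra.ι R (1 : Fin 2))) ^ k.2) ∧
    Submodule.span R (Set.range (fun k : ℕ × ℕ =>
      (RingQuot.mkAlgHom R (MonogonRel R t) (FreeAlgebra.ι R (0 : Fin 2))) ^ k.1 *
      (RingQuot.mkAlgHom R (MonogonRel R t) (FreeAlgebra.ι R (1 : Fin 2))) ^ k.2)) = ⊤ := by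
  constructor
  · refine LinearIndependent.of_comp
      ((LinearMap.applyₗ (Finsupp.single ((0 : ℕ), (0 : ℕ)) (1 : R))).comp
        (monogonRep t).toLinearMap) ?_
    convert Finsupp.linearIndependent_single_one R (ℕ × ℕ) using 1
    funext k
    exact monogonRep_monomial t k
  · set x := RingQuot.mkAlgHom R (MonogonRel R t) (FreeAlgebra.ι R (0 : Fin 2))
    set y := RingQuot.mkAlgHom R (MonogonRel R t) (FreeAlgebra.ι R (1 : Fin 2))
    have hyx : y * x = (t : R) ^ 4 • (x * y) + (1 - (t : R) ^ 4) • 1 :=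
      (monogon_relation_iff t x y).1
        (by simpa using RingQuot.mkAlgHom_rel R (MonogonRel.rel (R := R) (t := t)))
    set S := Submodule.span R (Set.range fun k : ℕ × ℕ => x ^ k.1 * y ^ k.2)
    have hmem (a b : ℕ) : x ^ a * y ^ b ∈ S := Submodule.subset_span ⟨(a, b), rfl⟩
    have hmul {z : RingQuot (MonogonRel R t)} (hz : ∀ a b : ℕ, z * (x ^ a * y ^ b) ∈ S) :
        ∀ s ∈ S, z * s ∈ S := by
      refine fun s hs => (Submodule.span_le (p := S.comap (LinearMap.mulLeft R z))).2 ?_ hs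
      rintro _ ⟨⟨a, b⟩, rfl⟩
      exact hz a b
    have hx_mem (a b : ℕ) : x * (x ^ a * y ^ b) ∈ S := by
      rw [← mul_assoc, ← pow_succ']
      exact hmem _ _
    have hy_mem (a b : ℕ) : y * (x ^ a * y ^ b) ∈ S := by
      rw [← mul_assoc, mul_pow_of_monogon_relation hyx, add_mul, smul_mul_assoc,
        smul_mul_assoc, mul_assoc, ← pow_succ']
      exact S.add_mem (S.smul_mem _ (hmem _ _)) (S.smul_mem _ (hmem _ _))
    refine eq_top_iff.2 fun z _ => ?_
    obtain ⟨w, rfl⟩ := RingQuot.mkAlgHom_surjective R (MonogonRel R t) z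
    have hw := mul_mem_of_forall_ι_mul_mem (RingQuot.mkAlgHom R (MonogonRel R t)) S
      (Fin.forall_fin_two.2 ⟨hmul hx_mem, hmul hy_mem⟩) w 1 (by simpa using hmem 0 0)
    rwa [mul_one] at hw
end

section
/- Let R be a commutative ring with a distinguished unit t that is moreover a domain, and write q^{1/2} := t, q := t². Let A_R be the quotient of the free R-algebra on two generators y₊, y₋ by the two-sided ideal generated by the single element q·y₊y₋ − q⁻¹·y₋y₊ − (q − q⁻¹)·1. Then A_R is a domain (it has no zero divisors: a·b = 0 implies a = 0 or b = 0). -/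
namespace Monogon

open Polynomial

variable {R : Type*} [CommRing R]

/-- The ordered evaluation `∑ Yⁱ aᵢ(X) ↦ ∑ yⁱ aᵢ(x)` at two possibly noncommuting elements. -/
noncomputable def orderedEval {B : Type*} [Semiring B] [Algebra R B] (y x : B) :
    R[X][X] →ₗ[R] B :=
  Polynomial.lsum fun i => LinearMap.mulLeft R (y ^ i) ∘ₗ (aeval x).toLinearMap

section OrderedEval

variable {B : Type*} [Semiring B] [Algebra R B] (y x : B)

lemma orderedEval_eq_sum (P : R[X][X]) :
    orderedEval y x P = P.sum fun i a => y ^ i * aeval x a := rfl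

lemma orderedEval_monomial (i : ℕ) (a : R[X]) :
    orderedEval y x (monomial i a) = y ^ i * aeval x a := by
  rw [orderedEval_eq_sum, sum_monomial_index _ _ (by simp)]

lemma map_orderedEval {B' : Type*} [Semiring B'] [Algebra R B'] (f : B →ₐ[R] B') (P : R[X][X]) :
    f (orderedEval y x P) = orderedEval (f y) (f x) P := by
  simp only [orderedEval_eq_sum, Polynomial.sum_def, map_sum, map_mul, map_pow, aeval_algHom_apply]

lemma mul_left_mem_range_orderedEval {b : B} (hb : b ∈ LinearMap.range (orderedEval (R := R) y x)) :
    y * b ∈ LinearMap.range (orderedEval (R := R) y x) := by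
  obtain ⟨P, rfl⟩ := hb
  induction P using Polynomial.induction_on' with
  | add P Q hP hQ => rw [map_add, mul_add]; exact add_mem hP hQ
  | monomial i a =>
    exact ⟨monomial (i + 1) a, by rw [orderedEval_monomial, orderedEval_monomial, pow_succ',
      mul_assoc]⟩

lemma mul_right_mem_range_orderedEval {y x : B} {p : R}
    (h : x * y = p • (y * x) + (1 - p) • (1 : B)) {b : B}
    (hb : b ∈ LinearMap.range (orderedEval (R := R) y x)) :
    x * b ∈ LinearMap.range (orderedEval (R := R) y x) := by
  obtain ⟨P, rfl⟩ := hb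
  induction P using Polynomial.induction_on' with
  | add P Q hP hQ => rw [map_add, mul_add]; exact add_mem hP hQ
  | monomial i a =>
    induction i with
    | zero =>
      exact ⟨monomial 0 (X * a), by
        rw [orderedEval_monomial, orderedEval_monomial, map_mul, aeval_X, pow_zero, one_mul,
          one_mul]⟩
    | succ i ih =>
      have key : x * orderedEval y x (monomial (i + 1) a) =
          p • (y * (x * orderedEval y x (monomial i a))) +
            (1 - p) • orderedEval y x (monomial i a) := by
        rw [orderedEval_monomial, orderedEval_monomial, pow_succ', mul_assoc, ← mul_assoc x, h]
        simp only [add_mul, smul_mul_assoc, one_mul, mul_assoc]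
      rw [key]
      exact add_mem (Submodule.smul_mem _ _ (mul_left_mem_range_orderedEval y x ih))
        (Submodule.smul_mem _ _ ⟨_, rfl⟩)

end OrderedEval

section Representation

variable (p : R)

/-- The substitution `Y ↦ p Y` on `R[X][Y]`. -/
noncomputable def dilate : R[X][X] →ₐ[R[X]] R[X][X] := aeval (C (C p) * X)

/-- Left multiplication by `Y` on normally ordered polynomials. -/
noncomputable def mulY : Module.End R R[X][X] := LinearMap.mulLeft R X

/-- Left multiplication by `x` on normally ordered polynomials, where `x y = p y x + (1 - p)`. -/
noncomputable def mulX : Module.End R R[X][X] where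
  toFun f := C X * dilate p f + divX (f - dilate p f)
  map_add' f g := by
    rw [map_add, add_sub_add_comm, divX_add]; ring
  map_smul' r f := by
    ext1 k
    simp [smul_sub, coeff_divX, dilate, ← Polynomial.comp_eq_aeval]

lemma coeff_dilate (f : R[X][X]) (k : ℕ) : (dilate p f).coeff k = f.coeff k * C p ^ k := by
  rw [dilate, ← comp_eq_aeval, comp_C_mul_X_coeff]

lemma coeff_mulX (f : R[X][X]) (k : ℕ) :
    (mulX p f).coeff k =
      X * C p ^ k * f.coeff k + (1 - C p ^ (k + 1)) * f.coeff (k + 1) := by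
  change (C X * dilate p f + divX (f - dilate p f)).coeff k = _
  rw [coeff_add, coeff_C_mul, coeff_divX, coeff_sub, coeff_dilate, coeff_dilate]
  ring

lemma mulX_mul_mulY : mulX p * mulY = p • (mulY * mulX p) + (1 - p) • 1 := by
  refine LinearMap.ext fun f => Polynomial.ext fun k => ?_
  simp only [Module.End.mul_apply, LinearMap.add_apply, LinearMap.smul_apply, Module.End.one_apply,
    coeff_add, coeff_smul, smul_eq_C_mul, C_sub, C_1, coeff_mulX, mulY, LinearMap.mulLeft_apply]
  rcases k with _ | k
  · simp
  · simp only [coeff_X_mul, coeff_mulX]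
    ring

lemma coeff_mulX_pow {f : R[X][X]} {k : ℕ} (hf : f.natDegree ≤ k) (j : ℕ) :
    ((mulX p ^ j) f).coeff k = (C (p ^ k) * X) ^ j * f.coeff k := by
  induction j generalizing k with
  | zero => simp
  | succ j ih =>
    rw [pow_succ', Module.End.mul_apply, coeff_mulX, ih hf, ih (hf.trans k.le_succ),
      coeff_eq_zero_of_natDegree_lt (Nat.lt_succ_of_le hf), C_pow]
    ring

lemma coeff_aeval_mulX {f : R[X][X]} {k : ℕ} (hf : f.natDegree ≤ k) (a : R[X]) :
    (aeval (mulX p) a f).coeff k = a.comp (C (p ^ k) * X) * f.coeff k := by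
  induction a using Polynomial.induction_on' with
  | add a b ha hb => rw [map_add, LinearMap.add_apply, coeff_add, ha, hb, add_comp, add_mul]
  | monomial j r =>
    rw [aeval_monomial, monomial_comp, Module.End.mul_apply, Module.algebraMap_end_apply, coeff_smul,
      coeff_mulX_pow p hf, smul_eq_C_mul, mul_assoc]

lemma natDegree_aeval_mulX_le (f : R[X][X]) (a : R[X]) :
    (aeval (mulX p) a f).natDegree ≤ f.natDegree := by
  rw [natDegree_le_iff_coeff_eq_zero]
  intro k hk
  rw [coeff_aeval_mulX p hk.le, coeff_eq_zero_of_natDegree_lt hk, mul_zero]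

lemma aeval_mulX_one (a : R[X]) : aeval (mulX p) a 1 = C a := by
  ext1 k
  rw [coeff_aeval_mulX p (by simp)]
  rcases k with _ | k
  · simp
  · simp [coeff_one]

lemma mulY_pow_apply (i : ℕ) (f : R[X][X]) : (mulY ^ i : Module.End R R[X][X]) f = X ^ i * f := by
  rw [mulY, LinearMap.pow_mulLeft, LinearMap.mulLeft_apply]

lemma orderedEval_mulY_mulX_apply (P f : R[X][X]) :
    orderedEval mulY (mulX p) P f = P.sum fun i a => X ^ i * aeval (mulX p) a f := by
  simp only [orderedEval_eq_sum, Polynomial.sum_def, LinearMap.sum_apply, Module.End.mul_apply,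
    mulY_pow_apply]

lemma orderedEval_mulY_mulX_one (P : R[X][X]) : orderedEval mulY (mulX p) P 1 = P := by
  rw [orderedEval_mulY_mulX_apply]
  simp only [aeval_mulX_one, X_pow_mul_C, sum_C_mul_X_pow_eq]

lemma coeff_orderedEval_mulY_mulX_apply (P f : R[X][X]) :
    (orderedEval mulY (mulX p) P f).coeff (f.natDegree + P.natDegree) =
      P.leadingCoeff.comp (C (p ^ f.natDegree) * X) * f.leadingCoeff := by
  rw [orderedEval_mulY_mulX_apply, sum_over_range _ (by simp), Finset.sum_range_succ, coeff_add,
    coeff_X_pow_mul, coeff_aeval_mulX p le_rfl, finsetSum_coeff, Finset.sum_eq_zero, zero_add]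
  · rfl
  · intro i hi
    rw [Finset.mem_range] at hi
    rw [coeff_X_pow_mul', if_pos (by omega), coeff_eq_zero_of_natDegree_lt]
    exact (natDegree_aeval_mulX_le p f _).trans_lt (by omega)

lemma orderedEval_mulY_mulX_apply_ne_zero [IsDomain R] {p : R} (hp : p ≠ 0) {P f : R[X][X]}
    (hP : P ≠ 0) (hf : f ≠ 0) : orderedEval mulY (mulX p) P f ≠ 0 := by
  intro h
  have hc := coeff_orderedEval_mulY_mulX_apply p P f
  rw [h, coeff_zero, eq_comm, mul_eq_zero] at hc
  rcases hc with hc | hc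
  · rw [comp_C_mul_X_eq_zero_iff (mem_nonZeroDivisors_of_ne_zero (pow_ne_zero _ hp))] at hc
    exact hP (leadingCoeff_eq_zero.1 hc)
  · exact hf (leadingCoeff_eq_zero.1 hc)

end Representation

section SkeinAlgebra

variable (t : Rˣ)

/-- The generator `y₊`. -/
noncomputable def yPlus : RingQuot (MonogonRel R t) :=
  RingQuot.mkAlgHom R (MonogonRel R t) (FreeAlgebra.ι R 0)

/-- The generator `y₋`. -/
noncomputable def yMinus : RingQuot (MonogonRel R t) :=
  RingQuot.mkAlgHom R (MonogonRel R t) (FreeAlgebra.ι R 1)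

/-- The parameter `q⁻²` governing the normal ordering of `y₊ y₋`. -/
def ratio : R := ((t⁻¹ : Rˣ) : R) ^ 4

lemma yPlus_mul_yMinus :
    yPlus t * yMinus t = ratio t • (yMinus t * yPlus t) + (1 - ratio t) • 1 := by
  have h := RingQuot.mkAlgHom_rel R (MonogonRel.rel (R := R) (t := t))
  simp only [map_add, map_smul, map_mul, map_one] at h
  have h2 := congrArg (fun z => (((t⁻¹ : Rˣ) : R) ^ 2) • z) h
  simp only [smul_add, smul_smul] at h2
  have ht : ((t⁻¹ : Rˣ) : R) ^ 2 * (t : R) ^ 2 = 1 := by rw [← mul_pow]; simp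
  rw [mul_sub, ht, one_smul, ← pow_add] at h2
  exact h2

/-- The action of the skein algebra on normally ordered polynomials. -/
noncomputable def rep : RingQuot (MonogonRel R t) →ₐ[R] Module.End R R[X][X] :=
  RingQuot.liftAlgHom R ⟨FreeAlgebra.lift R ![mulX (ratio t), mulY], by
    rintro _ _ ⟨⟩
    have ht : (t : R) ^ 2 * ratio t = ((t⁻¹ : Rˣ) : R) ^ 2 := by
      rw [ratio, show (4 : ℕ) = 2 + 2 from rfl, pow_add, ← mul_assoc, ← mul_pow]; simp
    simp only [map_add, map_smul, map_mul, map_one, FreeAlgebra.lift_ι_apply, Matrix.cons_val_zero,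
      Matrix.cons_val_one, mulX_mul_mulY, smul_add, smul_smul, mul_sub, mul_one, ht]⟩

lemma rep_yPlus : rep t (yPlus t) = mulX (ratio t) := by
  simp [rep, yPlus, RingQuot.liftAlgHom_mkAlgHom_apply]

lemma rep_yMinus : rep t (yMinus t) = mulY := by
  simp [rep, yMinus, RingQuot.liftAlgHom_mkAlgHom_apply]

lemma orderedEval_surjective :
    Function.Surjective (orderedEval (R := R) (yMinus t) (yPlus t)) := by
  have key : ∀ a, ∀ b ∈ LinearMap.range (orderedEval (R := R) (yMinus t) (yPlus t)),
      RingQuot.mkAlgHom R (MonogonRel R t) a * b ∈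
        LinearMap.range (orderedEval (R := R) (yMinus t) (yPlus t)) := by
    intro a
    induction a using FreeAlgebra.induction with
    | grade0 r =>
      intro b hb
      rw [AlgHom.commutes, ← Algebra.smul_def]
      exact Submodule.smul_mem _ _ hb
    | grade1 i =>
      intro b hb
      fin_cases i
      · exact mul_right_mem_range_orderedEval (yPlus_mul_yMinus t) hb
      · exact mul_left_mem_range_orderedEval _ _ hb
    | mul a a' ha ha' =>
      intro b hb
      rw [map_mul, mul_assoc]
      exact ha _ (ha' _ hb)
    | add a a' ha ha' =>
      intro b hb
      rw [map_add, add_mul]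
      exact add_mem (ha _ hb) (ha' _ hb)
  intro c
  obtain ⟨a, rfl⟩ := RingQuot.mkAlgHom_surjective R (MonogonRel R t) c
  simpa using key a 1 ⟨monomial 0 1, by
    rw [orderedEval_monomial, map_one, pow_zero, one_mul]⟩

lemma rep_orderedEval (P : R[X][X]) :
    rep t (orderedEval (yMinus t) (yPlus t) P) = orderedEval mulY (mulX (ratio t)) P := by
  rw [map_orderedEval, rep_yPlus, rep_yMinus]

end SkeinAlgebra

end Monogon

/-- Let `R` be a commutative domain with a distinguished unit `t`,
`q := t²`, and let `A_R = R⟨y₊,y₋⟩/(q y₊y₋ − q⁻¹ y₋y₊ = q − q⁻¹)`.  Then `A_R` is a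
domain: it has no zero divisors. -/
theorem stmt6 {R : Type*} [CommRing R] [IsDomain R] (t : Rˣ) :
    ∀ a b : RingQuot (MonogonRel R t), a * b = 0 → a = 0 ∨ b = 0 := by
  intro a b hab
  obtain ⟨P, rfl⟩ := Monogon.orderedEval_surjective t a
  obtain ⟨Q, rfl⟩ := Monogon.orderedEval_surjective t b
  have h := congrArg (fun c => Monogon.rep t c 1) hab
  simp only [map_mul, Monogon.rep_orderedEval, Module.End.mul_apply, Monogon.orderedEval_mulY_mulX_one,
    map_zero, LinearMap.zero_apply] at h
  have hp : Monogon.ratio t ≠ 0 := pow_ne_zero _ (t⁻¹).ne_zero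
  by_contra! hne
  refine Monogon.orderedEval_mulY_mulX_apply_ne_zero hp ?_ ?_ h
  · rintro rfl; exact hne.1 (map_zero _)
  · rintro rfl; exact hne.2 (map_zero _)
end

section
/- Let R be a commutative Noetherian domain with a distinguished unit t, and write q^{1/2} := t, q := t². Let A_R be the quotient of the free R-algebra on two generators y₊, y₋ by the two-sided ideal generated by the single element q·y₊y₋ − q⁻¹·y₋y₊ − (q − q⁻¹)·1. Then A_R is a Noetherian ring. -/
/-- The span of the powers `x ^ i` with `i < n`. -/
def powSpan (B : Type*) {A : Type*} [CommRing B] [Ring A] [Module B A] (x : A) (n : ℕ) :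
    Submodule B A :=
  Submodule.span B ((fun i => x ^ i) '' Set.Iio n)

section OreFiltration

variable {B A : Type*} [CommRing B] [Ring A] [Module B A]

theorem powSpan_mono (x : A) : Monotone (powSpan B x) := fun _ _ h =>
  Submodule.span_mono (Set.image_mono (Set.Iio_subset_Iio h))

theorem pow_mem_powSpan (x : A) {i n : ℕ} (h : i < n) : x ^ i ∈ powSpan B x n :=
  Submodule.subset_span ⟨i, h, rfl⟩

theorem exists_sub_mem_of_mem_powSpan_succ {x a : A} {n : ℕ} (h : a ∈ powSpan B x (n + 1)) :
    ∃ c : B, a - c • x ^ n ∈ powSpan B x n := by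
  rw [powSpan, ← Order.succ_eq_add_one, Order.Iio_succ_eq_insert,
    Set.image_insert_eq, Submodule.mem_span_insert] at h
  obtain ⟨c, z, hz, rfl⟩ := h
  exact ⟨c, by simpa [powSpan] using hz⟩

variable [IsScalarTower B A A] {x : A} {σ : B →+* B}

theorem mul_mem_powSpan_succ
    (hσ : ∀ b : B, ∃ d : B, x * (b • (1 : A)) = σ b • x + d • (1 : A))
    {n : ℕ} {a : A} (h : a ∈ powSpan B x n) : x * a ∈ powSpan B x (n + 1) := by
  suffices a ∈ powSpan B x n ∧ x * a ∈ powSpan B x (n + 1) from this.2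
  refine Submodule.span_induction ?_ ?_ ?_ ?_ h
  · rintro _ ⟨i, hi, rfl⟩
    have hi' : i < n := hi
    exact ⟨pow_mem_powSpan x hi', by
      simpa only [← pow_succ'] using pow_mem_powSpan x (Nat.succ_lt_succ hi')⟩
  · simp
  · rintro a b - - ⟨ha, ha'⟩ ⟨hb, hb'⟩
    exact ⟨add_mem ha hb, by simpa only [mul_add] using add_mem ha' hb'⟩
  · rintro b a - ⟨ha, ha'⟩
    obtain ⟨d, hd⟩ := hσ b
    refine ⟨Submodule.smul_mem _ _ ha, ?_⟩
    have : x * (b • a) = σ b • (x * a) + d • a := by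
      rw [← one_mul a, ← smul_mul_assoc, ← mul_assoc, hd, add_mul, smul_mul_assoc, smul_mul_assoc,
        one_mul]
    rw [this]
    exact add_mem (Submodule.smul_mem _ _ ha')
      (Submodule.smul_mem _ _ (powSpan_mono x n.le_succ ha))

/-- The ideal of leading coefficients, in degree `n`, of a left ideal of an Ore-type extension;
coefficients are untwisted by `σ ^ n` so that these ideals increase with `n`. -/
def leadingIdeal (x : A) (σ : B →+* B) (I : Ideal A) (n : ℕ) : Ideal B where
  carrier := {b | ∃ a ∈ I, a - (σ ^ n) b • x ^ n ∈ powSpan B x n}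
  zero_mem' := ⟨0, I.zero_mem, by simp⟩
  add_mem' := by
    rintro b c ⟨a, ha, hab⟩ ⟨a', ha', hac⟩
    refine ⟨a + a', add_mem ha ha', ?_⟩
    rw [map_add, add_smul, add_sub_add_comm]
    exact add_mem hab hac
  smul_mem' := by
    rintro c b ⟨a, ha, hab⟩
    refine ⟨(σ ^ n) c • a, ?_, ?_⟩
    · rw [← one_mul a, ← smul_mul_assoc]
      exact I.mul_mem_left _ ha
    · rw [smul_eq_mul, map_mul, mul_smul, ← smul_sub]
      exact Submodule.smul_mem _ _ hab

theorem leadingIdeal_mono_left {I I' : Ideal A} (h : I ≤ I') (n : ℕ) :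
    leadingIdeal x σ I n ≤ leadingIdeal x σ I' n :=
  fun _ ⟨a, ha, hab⟩ => ⟨a, h ha, hab⟩

theorem leadingIdeal_mono
    (hσ : ∀ b : B, ∃ d : B, x * (b • (1 : A)) = σ b • x + d • (1 : A)) (I : Ideal A) :
    Monotone (leadingIdeal x σ I) := by
  refine monotone_nat_of_le_succ fun n b ⟨a, ha, hab⟩ => ⟨x * a, I.mul_mem_left _ ha, ?_⟩
  obtain ⟨d, hd⟩ := hσ ((σ ^ n) b)
  have h : x * a - (σ ^ (n + 1)) b • x ^ (n + 1)
      = x * (a - (σ ^ n) b • x ^ n) + d • x ^ n := by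
    have h' : x * ((σ ^ n) b • x ^ n) = σ ((σ ^ n) b) • x ^ (n + 1) + d • x ^ n := by
      rw [← one_mul (x ^ n), ← smul_mul_assoc, ← mul_assoc, hd, add_mul, smul_mul_assoc,
        smul_mul_assoc, one_mul, ← pow_succ']
    rw [mul_sub, h', pow_succ' σ, RingHom.mul_def, RingHom.comp_apply]
    abel
  rw [h]
  exact add_mem (mul_mem_powSpan_succ hσ hab)
    (Submodule.smul_mem _ _ (pow_mem_powSpan x n.lt_succ_self))

theorem le_of_leadingIdeal_le (hsurj : Function.Surjective σ)
    (hx : ∀ a : A, ∃ n, a ∈ powSpan B x n) {I I' : Ideal A} (hI : I ≤ I')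
    (h : ∀ n, leadingIdeal x σ I' n ≤ leadingIdeal x σ I n) : I' ≤ I := by
  suffices ∀ n, ∀ a ∈ powSpan B x n, a ∈ I' → a ∈ I from fun a ha =>
    (hx a).elim fun n hn => this n a hn ha
  intro n
  induction n with
  | zero =>
    intro a ha _
    have : a = 0 := by simpa [powSpan] using ha
    exact this ▸ I.zero_mem
  | succ n ih =>
    intro a ha haI
    obtain ⟨c, hc⟩ := exists_sub_mem_of_mem_powSpan_succ ha
    obtain ⟨b, rfl⟩ : ∃ b, (σ ^ n) b = c := by
      rw [RingHom.coe_pow]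
      exact hsurj.iterate n c
    obtain ⟨a', ha', hb⟩ := h n ⟨a, haI, hc⟩
    have := ih (a - a') (by simpa using sub_mem hc hb) (sub_mem haI (hI ha'))
    simpa using add_mem this ha'

open Polynomial in
/-- The ideal of `B[X]` which collects the leading coefficient ideals of `I` in all degrees. -/
def leadingPolynomialIdeal
    (hσ : ∀ b : B, ∃ d : B, x * (b • (1 : A)) = σ b • x + d • (1 : A)) (I : Ideal A) :
    Ideal B[X] where
  carrier := {p | ∀ n, p.coeff n ∈ leadingIdeal x σ I n}
  zero_mem' := by simp
  add_mem' hp hq n := by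
    rw [coeff_add]
    exact add_mem (hp n) (hq n)
  smul_mem' p q hq n := by
    rw [smul_eq_mul, coeff_mul]
    exact sum_mem fun ij hij => Ideal.mul_mem_left _ _
      (leadingIdeal_mono hσ I (Finset.HasAntidiagonal.antidiagonal.snd_le hij) (hq _))

/-- Hilbert's basis theorem for Ore-type extensions: `A` is generated over the Noetherian ring `B`
by the powers of `x`, and `x` commutes with `B` up to a surjective endomorphism `σ` and terms of
degree zero in `x`. -/
theorem isNoetherianRing_of_powSpan [IsNoetherianRing B] (hsurj : Function.Surjective σ)
    (hσ : ∀ b : B, ∃ d : B, x * (b • (1 : A)) = σ b • x + d • (1 : A))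
    (hx : ∀ a : A, ∃ n, a ∈ powSpan B x n) : IsNoetherianRing A := by
  have hmono : StrictMono (leadingPolynomialIdeal hσ) := by
    intro I I' hI
    refine lt_of_le_not_ge (fun p hp n => leadingIdeal_mono_left hI.le n (hp n)) fun h => ?_
    refine hI.not_ge (le_of_leadingIdeal_le hsurj hx hI.le fun n b hb => ?_)
    have hmem : Polynomial.monomial n b ∈ leadingPolynomialIdeal hσ I' := fun m => by
      rw [Polynomial.coeff_monomial]
      split_ifs with hnm
      · exact hnm ▸ hb
      · exact zero_mem _
    simpa using h hmem n
  exact isNoetherian_iff'.2 hmono.wellFoundedGT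

end OreFiltration

open Polynomial in
theorem isNoetherianRing_of_mul_eq {R A : Type*} [CommRing R] [IsNoetherianRing R] [Ring A]
    [Algebra R A] {x y : A} (u : Rˣ) (c : R)
    (hxy : x * y = (u : R) • (y * x) + c • (1 : A))
    (hgen : Algebra.adjoin R {x, y} = ⊤) : IsNoetherianRing A := by
  let : Module R[X] A := Module.compHom A (aeval y).toRingHom
  have smul_def (p : R[X]) (a : A) : p • a = aeval y p * a := rfl
  have : IsScalarTower R[X] A A := ⟨fun p a b => mul_assoc _ a b⟩
  let σ : R[X] →ₐ[R] R[X] := aeval (C (u : R) * X)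
  have hσX : σ X = C (u : R) * X := aeval_X _
  have hsurj : Function.Surjective σ := by
    rw [← AlgHom.range_eq_top, eq_top_iff, ← adjoin_X, Algebra.adjoin_le_iff,
      Set.singleton_subset_iff]
    refine ⟨C ((u⁻¹ : Rˣ) : R) * X, ?_⟩
    change σ _ = X
    rw [C_mul', map_smul, hσX, C_mul', smul_smul, Units.inv_mul, one_smul]
  have hσ (p : R[X]) : ∃ d : R[X], x * (p • (1 : A)) = σ p • x + d • (1 : A) := by
    simp only [smul_def, mul_one]
    induction p using Polynomial.induction_on' with
    | add p q hp hq =>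
      obtain ⟨d, hd⟩ := hp
      obtain ⟨e, he⟩ := hq
      exact ⟨d + e, by simp only [map_add, mul_add, add_mul, hd, he]; abel⟩
    | monomial n r =>
      induction n with
      | zero =>
        refine ⟨0, ?_⟩
        rw [monomial_zero_left, ← algebraMap_eq, AlgHom.commutes, AlgHom.commutes, AlgHom.commutes,
          map_zero, add_zero, Algebra.commutes]
      | succ n ih =>
        obtain ⟨d, hd⟩ := ih
        refine ⟨C c * σ (monomial n r) + d * X, ?_⟩
        rw [← monomial_mul_X, map_mul, map_mul, aeval_X, ← mul_assoc, hd, hσX, add_mul, mul_assoc,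
          hxy, map_add, map_mul, map_mul, map_mul, map_mul, aeval_X, aeval_C, aeval_C, mul_add,
          Algebra.smul_def, Algebra.smul_def, mul_one, ← Algebra.commutes c]
        simp only [mul_assoc, add_assoc]
  refine isNoetherianRing_of_powSpan (B := R[X]) (x := x) (σ := (σ : R[X] →+* R[X])) hsurj hσ ?_
  suffices ∀ a : A, ∀ n, ∀ s ∈ powSpan R[X] x n, ∃ m, a * s ∈ powSpan R[X] x m by
    intro a
    simpa using this a 1 1 (by simpa using pow_mem_powSpan x one_pos)
  intro a
  have ha : a ∈ Algebra.adjoin R {x, y} := hgen ▸ Algebra.mem_top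
  induction ha using Algebra.adjoin_induction with
  | mem a ha =>
    intro n s hs
    obtain rfl | rfl := ha
    · exact ⟨n + 1, mul_mem_powSpan_succ hσ hs⟩
    · refine ⟨n, ?_⟩
      simpa [smul_def] using Submodule.smul_mem (powSpan R[X] x n) (X : R[X]) hs
  | algebraMap r =>
    intro n s hs
    refine ⟨n, ?_⟩
    simpa [smul_def] using Submodule.smul_mem (powSpan R[X] x n) (C r) hs
  | add a b _ _ ha hb =>
    intro n s hs
    obtain ⟨k, hk⟩ := ha n s hs
    obtain ⟨l, hl⟩ := hb n s hs
    refine ⟨max k l, ?_⟩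
    rw [add_mul]
    exact add_mem (powSpan_mono x (le_max_left k l) hk) (powSpan_mono x (le_max_right k l) hl)
  | mul a b _ _ ha hb =>
    intro n s hs
    obtain ⟨k, hk⟩ := hb n s hs
    simpa only [mul_assoc] using ha k _ hk

theorem adjoin_mkAlgHom_ι_eq_top {R : Type*} [CommRing R]
    (r : FreeAlgebra R (Fin 2) → FreeAlgebra R (Fin 2) → Prop) :
    Algebra.adjoin R {RingQuot.mkAlgHom R r (FreeAlgebra.ι R 1),
      RingQuot.mkAlgHom R r (FreeAlgebra.ι R 0)} = ⊤ := by
  have h : (RingQuot.mkAlgHom R r).range = ⊤ :=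
    (AlgHom.range_eq_top _).2 (RingQuot.mkAlgHom_surjective R r)
  rw [← h, ← Algebra.map_top, ← FreeAlgebra.adjoin_range_ι, AlgHom.map_adjoin]
  congr 1
  ext z
  simp [Fin.exists_fin_two, eq_comm, or_comm]

theorem adjoin_op_pair_eq_top {R A : Type*} [CommRing R] [Ring A] [Algebra R A] {x y : A}
    (h : Algebra.adjoin R {x, y} = ⊤) :
    Algebra.adjoin R {MulOpposite.op x, MulOpposite.op y} = ⊤ := by
  have := Subalgebra.op_adjoin (R := R) ({x, y} : Set A)
  rw [h, Subalgebra.op_top] at this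
  rw [this]
  congr 1
  ext z
  simp [← MulOpposite.unop_inj]

/-- An algebra generated by two elements which satisfy the skein relation of the 1-marked monogon
is left and right Noetherian. -/
theorem isNoetherianRing_and_op_of_smul_mul_eq {R A : Type*} [CommRing R] [IsNoetherianRing R]
    [Ring A] [Algebra R A] {x y : A} (t : Rˣ)
    (hrel : ((t : R) ^ 2) • (y * x) = (((t⁻¹ : Rˣ) : R) ^ 2) • (x * y) +
      ((t : R) ^ 2 - ((t⁻¹ : Rˣ) : R) ^ 2) • (1 : A))
    (hgen : Algebra.adjoin R {x, y} = ⊤) : IsNoetherianRing A ∧ IsNoetherianRing Aᵐᵒᵖ := by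
  have h₁ : ((t : R) ^ 2) * ((t⁻¹ : Rˣ) : R) ^ 2 = 1 := by rw [← mul_pow]; simp
  have h₂ : (((t⁻¹ : Rˣ) : R) ^ 2) * (t : R) ^ 2 = 1 := by rw [← mul_pow]; simp
  constructor
  · refine isNoetherianRing_of_mul_eq (t ^ 4)
      (-((t : R) ^ 2 * ((t : R) ^ 2 - ((t⁻¹ : Rˣ) : R) ^ 2))) ?_ hgen
    have h := congrArg (((t : R) ^ 2) • ·) hrel
    simp only [smul_add, smul_smul, h₁, one_smul] at h
    rw [Units.val_pow_eq_pow_val, neg_smul, ← sub_eq_add_neg, eq_sub_iff_add_eq, ← h]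
    congr 1
    ring
  · refine isNoetherianRing_of_mul_eq (t⁻¹ ^ 4)
      (((t⁻¹ : Rˣ) : R) ^ 2 * ((t : R) ^ 2 - ((t⁻¹ : Rˣ) : R) ^ 2)) ?_ (adjoin_op_pair_eq_top hgen)
    have h := congrArg ((((t⁻¹ : Rˣ) : R) ^ 2) • ·) hrel
    simp only [smul_add, smul_smul, h₂, one_smul] at h
    apply MulOpposite.unop_injective
    simp only [MulOpposite.unop_mul, MulOpposite.unop_op, MulOpposite.unop_add,
      MulOpposite.unop_smul, MulOpposite.unop_one]
    rw [h, Units.val_pow_eq_pow_val]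
    congr 2
    ring

/-- Let `R` be a commutative Noetherian domain with a distinguished
unit `t`, `q := t²`, and let `A_R = R⟨y₊,y₋⟩/(q y₊y₋ − q⁻¹ y₋y₊ = q − q⁻¹)`.  Then
`A_R` is a Noetherian ring (left and right Noetherian). -/
theorem stmt7 {R : Type*} [CommRing R] [IsDomain R] [IsNoetherianRing R] (t : Rˣ) :
    IsNoetherianRing (RingQuot (MonogonRel R t)) ∧
      IsNoetherianRing (RingQuot (MonogonRel R t))ᵐᵒᵖ := by
  have hgen := adjoin_mkAlgHom_ι_eq_top (MonogonRel R t)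
  have hrel := RingQuot.mkAlgHom_rel R (MonogonRel.rel (R := R) (t := t))
  simp only [map_add, map_smul, map_mul, map_one] at hrel
  exact isNoetherianRing_and_op_of_smul_mul_eq t hrel hgen
end

section
/- Let R be a commutative ring with a distinguished unit t, and write q^{1/2} := t, q := t². Let B_R be the quotient of the free R-algebra on two generators u₊, u₋ by the two-sided ideal generated by the two elements q·u₊u₋ − q⁻¹·u₋u₊ − (q − q⁻¹)·1 and u₊u₋ − 1. Then there is an R-algebra isomorphism from B_R to the Laurent polynomial ring R[u, u⁻¹] sending the class of u₊ to u and the class of u₋ to u⁻¹. -/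
/-- The defining relations of the reduced (LRY) skein algebra of the 1-marked monogon
over a commutative ring `R` with distinguished unit `t` (`q^{1/2} := t`, `q := t²`):
the relations `q·u₊u₋ = q⁻¹·u₋u₊ + (q − q⁻¹)·1` and `u₊u₋ = 1` in the free algebra on
the two generators `u₊ = ι 0`, `u₋ = ι 1`. -/
inductive RedMonogonRel (R : Type*) [CommRing R] (t : Rˣ) :
    FreeAlgebra R (Fin 2) → FreeAlgebra R (Fin 2) → Prop
  | skein : RedMonogonRel R t
      (((t : R) ^ 2) • (FreeAlgebra.ι R (0 : Fin 2) * FreeAlgebra.ι R (1 : Fin 2)))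
      ((((t⁻¹ : Rˣ) : R) ^ 2) • (FreeAlgebra.ι R (1 : Fin 2) * FreeAlgebra.ι R (0 : Fin 2)) +
        ((t : R) ^ 2 - ((t⁻¹ : Rˣ) : R) ^ 2) • (1 : FreeAlgebra R (Fin 2)))
  | inv : RedMonogonRel R t
      (FreeAlgebra.ι R (0 : Fin 2) * FreeAlgebra.ι R (1 : Fin 2)) 1

namespace RedMonogonRel

variable {R : Type*} [CommRing R] (t : Rˣ)

/-- The class of the generator indexed by `i` in the reduced monogon algebra. -/
noncomputable def gen (i : Fin 2) : RingQuot (RedMonogonRel R t) :=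
  RingQuot.mkAlgHom R (RedMonogonRel R t) (FreeAlgebra.ι R i)

theorem gen_zero_mul_gen_one : gen t 0 * gen t 1 = 1 := by
  simpa [gen] using RingQuot.mkAlgHom_rel R (RedMonogonRel.inv (R := R) (t := t))

theorem gen_one_mul_gen_zero : gen t 1 * gen t 0 = 1 := by
  have h := RingQuot.mkAlgHom_rel R (RedMonogonRel.skein (R := R) (t := t))
  simp only [map_smul, map_add, map_mul, map_one] at h
  change (t : R) ^ 2 • (gen t 0 * gen t 1) =
    ((t⁻¹ : Rˣ) : R) ^ 2 • (gen t 1 * gen t 0) + _ at h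
  rw [gen_zero_mul_gen_one] at h
  simp only [Algebra.smul_def, map_sub, mul_one] at h
  rw [← sub_eq_iff_eq_add, sub_sub_cancel] at h
  have hu : IsUnit (algebraMap R (RingQuot (RedMonogonRel R t)) (((t⁻¹ : Rˣ) : R) ^ 2)) :=
    ((t⁻¹ : Rˣ).isUnit.pow 2).map _
  exact (hu.mul_left_cancel ((mul_one _).trans h)).symm

/-- The class of `u₊` as a unit, with inverse the class of `u₋`. -/
noncomputable def genUnit : (RingQuot (RedMonogonRel R t))ˣ where
  val := gen t 0
  inv := gen t 1
  val_inv := gen_zero_mul_gen_one t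
  inv_val := gen_one_mul_gen_zero t

/-- The algebra map to Laurent polynomials with `u₊ ↦ T 1` and `u₋ ↦ T (-1)`. -/
noncomputable def toLaurent : RingQuot (RedMonogonRel R t) →ₐ[R] LaurentPolynomial R :=
  RingQuot.liftAlgHom R
    ⟨FreeAlgebra.lift R ![LaurentPolynomial.T 1, LaurentPolynomial.T (-1)], by
      have h : LaurentPolynomial.T 1 * LaurentPolynomial.T (-1) = (1 : LaurentPolynomial R) := by
        rw [← LaurentPolynomial.T_add, add_neg_cancel, LaurentPolynomial.T_zero]
      rintro _ _ (_ | _)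
      · simp [h, mul_comm (LaurentPolynomial.T (-1)), ← add_smul]
      · simp [h]⟩

@[simp]
theorem toLaurent_gen_zero : toLaurent t (gen t 0) = LaurentPolynomial.T 1 := by
  simp [toLaurent, gen]

@[simp]
theorem toLaurent_gen_one : toLaurent t (gen t 1) = LaurentPolynomial.T (-1) := by
  simp [toLaurent, gen]

/-- The algebra map from Laurent polynomials with `T n ↦ u₊ ^ n`. -/
noncomputable def ofLaurent : LaurentPolynomial R →ₐ[R] RingQuot (RedMonogonRel R t) :=
  AddMonoidAlgebra.lift R _ ℤ ((Units.coeHom _).comp (zpowersHom _ (genUnit t)))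

theorem ofLaurent_T (n : ℤ) :
    ofLaurent t (LaurentPolynomial.T n) = ((genUnit t ^ n : (RingQuot (RedMonogonRel R t))ˣ) :
      RingQuot (RedMonogonRel R t)) := by
  rw [ofLaurent, LaurentPolynomial.T, AddMonoidAlgebra.lift_single]
  simp

theorem ofLaurent_T_one : ofLaurent t (LaurentPolynomial.T 1) = gen t 0 := by
  rw [ofLaurent_T, zpow_one]
  rfl

theorem ofLaurent_T_neg_one : ofLaurent t (LaurentPolynomial.T (-1)) = gen t 1 := by
  rw [ofLaurent_T, zpow_neg_one]
  rfl

theorem toLaurent_comp_ofLaurent :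
    (toLaurent t).comp (ofLaurent t) = AlgHom.id R (LaurentPolynomial R) := by
  refine AddMonoidAlgebra.algHom_ext' (MonoidHom.ext_mint ?_) (Subsingleton.elim _ _)
  change toLaurent t (ofLaurent t (LaurentPolynomial.T 1)) = LaurentPolynomial.T 1
  rw [ofLaurent_T_one, toLaurent_gen_zero]

theorem ofLaurent_comp_toLaurent :
    (ofLaurent t).comp (toLaurent t) = AlgHom.id R (RingQuot (RedMonogonRel R t)) := by
  apply RingQuot.ringQuot_ext'
  apply FreeAlgebra.hom_ext
  funext i
  change ofLaurent t (toLaurent t (gen t i)) = gen t i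
  fin_cases i
  · simpa using ofLaurent_T_one t
  · simpa using ofLaurent_T_neg_one t

/-- The reduced monogon algebra is the algebra of Laurent polynomials. -/
noncomputable def laurentEquiv : RingQuot (RedMonogonRel R t) ≃ₐ[R] LaurentPolynomial R :=
  AlgEquiv.ofAlgHom (toLaurent t) (ofLaurent t) (toLaurent_comp_ofLaurent t)
    (ofLaurent_comp_toLaurent t)

end RedMonogonRel

/-- Let `R` be a commutative ring with a distinguished unit `t`,
`q := t²`, and let
`B_R = R⟨u₊,u₋⟩/(q u₊u₋ − q⁻¹ u₋u₊ = q − q⁻¹, u₊u₋ = 1)`.  Then there is an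
`R`-algebra isomorphism `B_R ≃ R[u,u⁻¹]` (Laurent polynomials) sending the class of
`u₊` to `u = T 1` and the class of `u₋` to `u⁻¹ = T (-1)`. -/
theorem stmt8 {R : Type*} [CommRing R] (t : Rˣ) :
    ∃ e : RingQuot (RedMonogonRel R t) ≃ₐ[R] LaurentPolynomial R,
      e (RingQuot.mkAlgHom R (RedMonogonRel R t) (FreeAlgebra.ι R (0 : Fin 2))) =
        LaurentPolynomial.T 1 ∧
      e (RingQuot.mkAlgHom R (RedMonogonRel R t) (FreeAlgebra.ι R (1 : Fin 2))) =
        LaurentPolynomial.T (-1) := by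
  exact ⟨RedMonogonRel.laurentEquiv t, RedMonogonRel.toLaurent_gen_zero t,
    RedMonogonRel.toLaurent_gen_one t⟩
end

section
/- For i ∈ {1, 2, 3} (indices taken modulo 3) define Add_i : ℤ³ → ℤ by Add_i(n₁, n₂, n₃) = max(0, n_{i−1} − n_i − n_{i+1}). Let Λ₃ be the set of pairs ((n₁, n₂, n₃), (t₁, t₂, t₃)) ∈ ℕ³ × ℤ³ such that n₁ + n₂ + n₃ is even, each t_i is even, and for each i ∈ {1, 2, 3}, if n_i = 0 then t_i ≥ Add_i(n₁, n₂, n₃). Then Λ₃ is an additive submonoid of ℤ³ × ℤ³: it contains (0, 0) and is closed under componentwise addition. -/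
/-- `Add_i(n₁,n₂,n₃) = max(0, n_{i−1} − n_i − n_{i+1})`, indices taken modulo 3. -/
def addP3 (n : Fin 3 → ℤ) (i : Fin 3) : ℤ := max 0 (n (i - 1) - n i - n (i + 1))

/-- The set `Λ₃ ⊆ ℕ³ × ℤ³` of (modified Dehn–Thurston) coordinate pairs
`((n₁,n₂,n₃),(t₁,t₂,t₃))` with `n₁+n₂+n₃` even, each `t_i` even, and
`t_i ≥ Add_i(n)` whenever `n_i = 0`. -/
def Lambda3 : Set ((Fin 3 → ℤ) × (Fin 3 → ℤ)) :=
  {p | (∀ i, 0 ≤ p.1 i) ∧ Even (p.1 0 + p.1 1 + p.1 2) ∧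
       (∀ i, Even (p.2 i)) ∧ ∀ i, p.1 i = 0 → addP3 p.1 i ≤ p.2 i}

theorem addP3_zero (i : Fin 3) : addP3 0 i = 0 := by
  simp [addP3]

theorem addP3_add_le (m n : Fin 3 → ℤ) (i : Fin 3) :
    addP3 (m + n) i ≤ addP3 m i + addP3 n i := by
  simp only [addP3, Pi.add_apply]
  omega

/-- `Λ₃` is an additive submonoid of `ℤ³ × ℤ³`: it contains `(0,0)`
and is closed under componentwise addition. -/
theorem stmt9 :
    (0 : (Fin 3 → ℤ) × (Fin 3 → ℤ)) ∈ Lambda3 ∧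
      ∀ p ∈ Lambda3, ∀ q ∈ Lambda3, p + q ∈ Lambda3 := by
  refine ⟨⟨by simp, by simp, by simp, fun i _ => (addP3_zero i).le⟩, ?_⟩
  rintro ⟨m, s⟩ ⟨hm, hms, hs, hma⟩ ⟨n, t⟩ ⟨hn, hns, ht, hna⟩
  refine ⟨fun i => add_nonneg (hm i) (hn i), ?_, fun i => (hs i).add (ht i), fun i hi => ?_⟩
  · have key : m 0 + n 0 + (m 1 + n 1) + (m 2 + n 2) = m 0 + m 1 + m 2 + (n 0 + n 1 + n 2) := by
      ring
    exact key ▸ hms.add hns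
  · obtain ⟨hmi, hni⟩ := (add_eq_zero_iff_of_nonneg (hm i) (hn i)).mp hi
    exact (addP3_add_le m n i).trans (add_le_add (hma i hmi) (hna i hni))
end

section
/- Let Δ be a finite set ('edges'), let Δ_∂ ⊆ Δ ('boundary edges') with a disjoint copy Δ̂_∂ = {ê : e ∈ Δ_∂}, and set Δ̃ := Δ ⊔ Δ̂_∂. Let T be a set of triples (a, b, c) of elements of Δ ('triangular triples'). Let Λ ⊆ ℕ^{Δ̃} be the set of all n : Δ̃ → ℕ such that: for every triple (a, b, c) ∈ T, the sum n(a) + n(b) + n(c) is even and the three triangle inequalities n(a) ≤ n(b) + n(c), n(b) ≤ n(c) + n(a), n(c) ≤ n(a) + n(b) hold; and for every e ∈ Δ_∂, n(ê) is even and n(ê) ≤ 2·n(e). Then Λ is an additive submonoid of ℕ^{Δ̃} that is finitely generated as a monoid, and the subgroup of ℤ^{Δ̃} generated by Λ contains (2ℤ)^{Δ̃} (all functions Δ̃ → ℤ with even values); in particular the free abelian group generated by Λ has rank |Δ̃|. -/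
/-- The monoid `Λ` of triangulation coordinates: `Δ` is a (finite) set of edges,
`B ⊆ Δ` the boundary edges (with disjoint copies given by `Sum.inr`), `T` the set of
triangular triples.  `Λ` consists of all `n : Δ ⊔ B̂ → ℕ` such that for every
triangular triple `(a,b,c)` the sum `n(a)+n(b)+n(c)` is even and the three triangle
inequalities hold, and for every boundary edge `e`, `n(ê)` is even and
`n(ê) ≤ 2·n(e)`. -/
def triCoordMonoid {Δ : Type*} (B : Finset Δ) (T : Set (Δ × Δ × Δ)) :
    Set ((Δ ⊕ {e // e ∈ B}) → ℕ) :=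
  {n | (∀ a b c : Δ, (a, b, c) ∈ T →
          Even (n (Sum.inl a) + n (Sum.inl b) + n (Sum.inl c)) ∧
          n (Sum.inl a) ≤ n (Sum.inl b) + n (Sum.inl c) ∧
          n (Sum.inl b) ≤ n (Sum.inl c) + n (Sum.inl a) ∧
          n (Sum.inl c) ≤ n (Sum.inl a) + n (Sum.inl b)) ∧
       ∀ e : {e // e ∈ B}, Even (n (Sum.inr e)) ∧ n (Sum.inr e) ≤ 2 * n (Sum.inl (e : Δ))}

namespace triCoordMonoid

variable {Δ : Type*} (B : Finset Δ) (T : Set (Δ × Δ × Δ))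

lemma zero_mem : 0 ∈ triCoordMonoid B T := by
  simp [triCoordMonoid]

variable {B T}

lemma add_mem {m n : (Δ ⊕ {e // e ∈ B}) → ℕ} (hm : m ∈ triCoordMonoid B T)
    (hn : n ∈ triCoordMonoid B T) : m + n ∈ triCoordMonoid B T := by
  refine ⟨fun a b c h => ?_, fun e => ?_⟩
  · have h₁ := hm.1 a b c h
    have h₂ := hn.1 a b c h
    simp only [Pi.add_apply]
    grind
  · have h₁ := hm.2 e
    have h₂ := hn.2 e
    simp only [Pi.add_apply]
    grind

variable (B T)

/-- The coordinate vectors together with half the slack in each defining inequality and half of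
each coordinate of a boundary copy. The parity and order conditions become linear equations. -/
def slackMonoid : AddSubmonoid
    (((Δ ⊕ {e // e ∈ B}) → ℕ) × (Δ × Δ × Δ → ℕ × ℕ × ℕ) × ({e // e ∈ B} → ℕ × ℕ)) where
  carrier := {x | (∀ t ∈ T,
        x.1 (Sum.inl t.2.1) + x.1 (Sum.inl t.2.2) = x.1 (Sum.inl t.1) + 2 * (x.2.1 t).1 ∧
        x.1 (Sum.inl t.2.2) + x.1 (Sum.inl t.1) = x.1 (Sum.inl t.2.1) + 2 * (x.2.1 t).2.1 ∧
        x.1 (Sum.inl t.1) + x.1 (Sum.inl t.2.1) = x.1 (Sum.inl t.2.2) + 2 * (x.2.1 t).2.2) ∧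
      ∀ e : {e // e ∈ B}, x.1 (Sum.inr e) = 2 * (x.2.2 e).1 ∧
        x.1 (Sum.inl (e : Δ)) = (x.2.2 e).1 + (x.2.2 e).2}
  zero_mem' := by simp
  add_mem' := by
    rintro x y ⟨hx, hx'⟩ ⟨hy, hy'⟩
    refine ⟨fun t ht => ?_, fun e => ?_⟩
    · have h₁ := hx t ht
      have h₂ := hy t ht
      simp only [Prod.fst_add, Prod.snd_add, Pi.add_apply]
      omega
    · have h₁ := hx' e
      have h₂ := hy' e
      simp only [Prod.fst_add, Prod.snd_add, Pi.add_apply]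
      omega

lemma slackMonoid_fg [Finite Δ] : (slackMonoid B T).FG := by
  refine AddSubmonoid.fg_of_subtractive ?_
  rintro x ⟨hx, hx'⟩ y ⟨hxy, hxy'⟩
  refine ⟨fun t ht => ?_, fun e => ?_⟩
  · have h₁ := hx t ht
    have h₂ := hxy t ht
    simp only [Prod.fst_add, Prod.snd_add, Pi.add_apply] at h₂
    omega
  · have h₁ := hx' e
    have h₂ := hxy' e
    simp only [Prod.fst_add, Prod.snd_add, Pi.add_apply] at h₂
    omega

lemma coe_map_fst_slackMonoid :
    ((slackMonoid B T).map (AddMonoidHom.fst _ _) : Set ((Δ ⊕ {e // e ∈ B}) → ℕ)) =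
      triCoordMonoid B T := by
  ext n
  constructor
  · rintro ⟨x, ⟨hx, hx'⟩, rfl⟩
    refine ⟨fun a b c h => ?_, fun e => ?_⟩
    · have := hx _ h
      simp only [AddMonoidHom.coe_fst, Nat.even_iff] at this ⊢
      omega
    · have := hx' e
      simp only [AddMonoidHom.coe_fst, Nat.even_iff]
      omega
  · rintro ⟨hn, hn'⟩
    refine ⟨(n,
      fun t => ((n (Sum.inl t.2.1) + n (Sum.inl t.2.2) - n (Sum.inl t.1)) / 2,
        (n (Sum.inl t.2.2) + n (Sum.inl t.1) - n (Sum.inl t.2.1)) / 2,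
        (n (Sum.inl t.1) + n (Sum.inl t.2.1) - n (Sum.inl t.2.2)) / 2),
      fun e => (n (Sum.inr e) / 2, n (Sum.inl (e : Δ)) - n (Sum.inr e) / 2)), ⟨?_, ?_⟩, rfl⟩
    · rintro ⟨a, b, c⟩ h
      have := hn a b c h
      simp only [Nat.even_iff] at this ⊢
      omega
    · intro e
      have := hn' e
      simp only [Nat.even_iff] at this ⊢
      omega

lemma exists_finset_closure [Finite Δ] : ∃ S : Finset ((Δ ⊕ {e // e ∈ B}) → ℕ),
    (AddSubmonoid.closure (S : Set ((Δ ⊕ {e // e ∈ B}) → ℕ)) : Set _) = triCoordMonoid B T := by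
  obtain ⟨S, hS⟩ := (slackMonoid_fg B T).map (AddMonoidHom.fst _ _)
  exact ⟨S, by rw [hS, coe_map_fst_slackMonoid]⟩

/-- Every even vector is the difference of two elements of `triCoordMonoid B T`: a large vector
in the interior of the cone, and its translate by the even vector. -/
lemma mem_span_of_even [Finite Δ] {g : (Δ ⊕ {e // e ∈ B}) → ℤ} (hg : ∀ x, Even (g x)) :
    g ∈ Submodule.span ℤ
      ((fun n : (Δ ⊕ {e // e ∈ B}) → ℕ => fun x => (n x : ℤ)) '' triCoordMonoid B T) := by
  obtain ⟨K, hK⟩ : ∃ K : ℕ, ∀ x, |g x| ≤ K := by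
    obtain ⟨K, hK⟩ := (Set.finite_range fun x => (g x).natAbs).bddAbove
    exact ⟨K, fun x => by
      rw [Int.abs_eq_natAbs]
      exact_mod_cast hK ⟨x, rfl⟩⟩
  let m : (Δ ⊕ {e // e ∈ B}) → ℕ := Sum.elim (fun _ => 4 * K) (fun _ => 2 * K)
  have hm_inl (a : Δ) : m (Sum.inl a) = 4 * K := rfl
  have hm_inr (e : {e // e ∈ B}) : m (Sum.inr e) = 2 * K := rfl
  have hle (x) : -(K : ℤ) ≤ g x ∧ g x ≤ K ∧ g x % 2 = 0 :=
    ⟨(abs_le.1 (hK x)).1, (abs_le.1 (hK x)).2, Int.even_iff.1 (hg x)⟩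
  have hm : m ∈ triCoordMonoid B T := by
    refine ⟨fun a b c _ => ?_, fun e => ?_⟩
    · simp only [hm_inl, Nat.even_iff]
      omega
    · simp only [hm_inl, hm_inr, Nat.even_iff]
      omega
  have hmg : (fun x => (m x + g x).toNat) ∈ triCoordMonoid B T := by
    refine ⟨fun a b c _ => ?_, fun e => ?_⟩
    · have ha := hle (Sum.inl a)
      have hb := hle (Sum.inl b)
      have hc := hle (Sum.inl c)
      simp only [hm_inl, Nat.even_iff]
      omega
    · have h₁ := hle (Sum.inl e)
      have h₂ := hle (Sum.inr e)
      simp only [hm_inl, hm_inr, Nat.even_iff]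
      omega
  have hx (x) : ((m x + g x).toNat : ℤ) = m x + g x := by
    refine Int.toNat_of_nonneg ?_
    have := hle x
    rcases x with a | e
    · rw [hm_inl]; omega
    · rw [hm_inr]; omega
  have hg_eq : g = (fun x => ((m x + g x).toNat : ℤ)) - fun x => (m x : ℤ) := by
    funext x
    simp [hx]
  rw [hg_eq]
  exact Submodule.sub_mem _ (Submodule.subset_span ⟨_, hmg, rfl⟩)
    (Submodule.subset_span ⟨_, hm, rfl⟩)

end triCoordMonoid

/-- A submodule of `ℤ^ι` containing all even vectors has full rank. -/
lemma Submodule.finrank_eq_card_of_even_mem {ι : Type*} [Fintype ι] (N : Submodule ℤ (ι → ℤ))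
    (hN : ∀ g : ι → ℤ, (∀ x, Even (g x)) → g ∈ N) :
    Module.finrank ℤ N = Fintype.card ι := by
  rw [← Module.finrank_fintype_fun_eq_card ℤ (η := ι)]
  refine le_antisymm N.finrank_le ?_
  refine LinearMap.finrank_le_finrank_of_injective
    (f := (LinearMap.lsmul ℤ (ι → ℤ) 2).codRestrict N fun f => hN _ fun x => by simp) ?_
  intro f g h
  exact smul_right_injective (ι → ℤ) (two_ne_zero (α := ℤ)) (congrArg Subtype.val h)

/-- `Λ = triCoordMonoid B T` is an additive submonoid of `ℕ^{Δ̃}`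
(`Δ̃ = Δ ⊔ B̂`), finitely generated as a monoid; the subgroup of `ℤ^{Δ̃}` generated by
`Λ` contains `(2ℤ)^{Δ̃}`; in particular the free abelian group generated by `Λ` has
rank `|Δ̃|`. -/
theorem stmt10 {Δ : Type*} [Fintype Δ] [DecidableEq Δ]
    (B : Finset Δ) (T : Set (Δ × Δ × Δ)) :
    (0 ∈ triCoordMonoid B T) ∧
    (∀ a ∈ triCoordMonoid B T, ∀ b ∈ triCoordMonoid B T, a + b ∈ triCoordMonoid B T) ∧
    (∃ S : Finset ((Δ ⊕ {e // e ∈ B}) → ℕ), ↑S ⊆ triCoordMonoid B T ∧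
      ∀ a ∈ triCoordMonoid B T, a ∈ AddSubmonoid.closure (S : Set ((Δ ⊕ {e // e ∈ B}) → ℕ))) ∧
    (∀ g : (Δ ⊕ {e // e ∈ B}) → ℤ, (∀ x, Even (g x)) →
      g ∈ Submodule.span ℤ
        ((fun n : (Δ ⊕ {e // e ∈ B}) → ℕ => fun x => (n x : ℤ)) '' triCoordMonoid B T)) ∧
    Module.finrank ℤ
        ↥(Submodule.span ℤ
          ((fun n : (Δ ⊕ {e // e ∈ B}) → ℕ => fun x => (n x : ℤ)) '' triCoordMonoid B T)) =
      Fintype.card (Δ ⊕ {e // e ∈ B}) := by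
  obtain ⟨S, hS⟩ := triCoordMonoid.exists_finset_closure B T
  have hspan (g : (Δ ⊕ {e // e ∈ B}) → ℤ) (hg : ∀ x, Even (g x)) :=
    triCoordMonoid.mem_span_of_even B T hg
  exact ⟨triCoordMonoid.zero_mem B T, fun a ha b hb => triCoordMonoid.add_mem ha hb,
    ⟨S, hS ▸ AddSubmonoid.subset_closure, fun a ha => hS.symm.subset ha⟩,
    hspan, Submodule.finrank_eq_card_of_even_mem _ hspan⟩
end
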